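/- Let n ∈ ℕ, n ≥ 1, let λ ∈ ℂ, and let u : ℝⁿ → ℂ be a locally integrable function with compact support such that ∫_{ℝⁿ} u(x) · (Δφ(x) + λ φ(x)) dx = 0 for every smooth compactly supported function φ : ℝⁿ → ℂ, where Δφ = Σ_{k=1}^n ∂²φ/∂x_k² denotes the Laplacian. Then u = 0 Lebesgue-almost everywhere. -/

import Mathlib

open MeasureTheory

open scoped FourierTransform RealInnerProductSpace

/-- The plane wave `x ↦ exp (-2πi ⟨x, ξ⟩)`. -/
noncomputable def planeWave {n : ℕ} (ξ : EuclideanSpace ℝ (Fin n)) :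
    EuclideanSpace ℝ (Fin n) → ℂ :=
  fun x => Complex.exp (((-2 * Real.pi * ⟪x, ξ⟫ : ℝ) : ℂ) * Complex.I)

lemma planeWave_contDiff {n : ℕ} (ξ : EuclideanSpace ℝ (Fin n)) :
    ContDiff ℝ (⊤ : ℕ∞) (planeWave ξ) := by
  unfold planeWave
  refine ContDiff.cexp (ContDiff.mul ?_ contDiff_const)
  exact Complex.ofRealCLM.contDiff.comp
    (contDiff_const.mul (contDiff_id.inner ℝ contDiff_const))

lemma planeWave_fderiv {n : ℕ} (ξ x v : EuclideanSpace ℝ (Fin n)) :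
    fderiv ℝ (planeWave ξ) x v
      = (((-2 * Real.pi * ⟪v, ξ⟫ : ℝ) : ℂ) * Complex.I) * planeWave ξ x := by
  let L : EuclideanSpace ℝ (Fin n) →L[ℝ] ℂ :=
    (Complex.ofRealCLM.comp ((-2 * Real.pi) • (innerSL ℝ ξ))).smulRight Complex.I
  have hL : ∀ y, L y = ((-2 * Real.pi * ⟪y, ξ⟫ : ℝ) : ℂ) * Complex.I := by
    intro y
    simp [L, real_inner_comm]
  have hfun : planeWave ξ = fun y => Complex.exp (L y) := by
    funext y
    rw [hL]
    rfl
  have h1 : HasFDerivAt (fun y => Complex.exp (L y)) (Complex.exp (L x) • L) x :=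
    L.hasFDerivAt.cexp
  rw [hfun, h1.fderiv]
  simp only [smul_apply, smul_eq_mul, hL]
  ring

lemma planeWave_fderiv_fderiv {n : ℕ} (ξ x v : EuclideanSpace ℝ (Fin n)) :
    fderiv ℝ (fun y => fderiv ℝ (planeWave ξ) y v) x v
      = -((4 * Real.pi ^ 2 * ⟪v, ξ⟫ ^ 2 : ℝ) : ℂ) * planeWave ξ x := by
  simp_rw [planeWave_fderiv ξ _ v]
  rw [fderiv_const_mul ((planeWave_contDiff ξ).differentiable (by simp) x)]
  rw [smul_apply, planeWave_fderiv, smul_eq_mul]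
  push_cast
  linear_combination (4 * (Real.pi : ℂ) ^ 2 * (⟪v, ξ⟫ : ℂ) ^ 2 * planeWave ξ x) * Complex.I_sq

lemma planeWave_laplacian {n : ℕ} (ξ x : EuclideanSpace ℝ (Fin n)) :
    ∑ k : Fin n, fderiv ℝ (fun y => fderiv ℝ (planeWave ξ) y (EuclideanSpace.single k (1 : ℝ))) x
      (EuclideanSpace.single k (1 : ℝ))
      = -((4 * Real.pi ^ 2 * ‖ξ‖ ^ 2 : ℝ) : ℂ) * planeWave ξ x := by
  simp_rw [planeWave_fderiv_fderiv]
  rw [← Finset.sum_mul, Finset.sum_neg_distrib, EuclideanSpace.real_norm_sq_eq, Finset.mul_sum]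
  push_cast
  simp [EuclideanSpace.inner_single_left]

/-- **No compactly supported Helmholtz solutions (display (FGN-6), Gesztesy–Mitrea).**
Let `u : ℝⁿ → ℂ` be locally integrable with compact support and suppose that
`∫ u (Δφ + λ φ) = 0` for every smooth compactly supported `φ`, i.e. `u` is a compactly
supported distributional solution of `(−Δ − λ) u = 0` on `ℝⁿ`. Then `u = 0` a.e. -/
theorem compactly_supported_helmholtz_solution_eq_zero
    (n : ℕ) (hn : 1 ≤ n) (lam : ℂ) (u : EuclideanSpace ℝ (Fin n) → ℂ)
    (hu : LocallyIntegrable u volume) (hsupp : HasCompactSupport u)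
    (h : ∀ φ : EuclideanSpace ℝ (Fin n) → ℂ, ContDiff ℝ (⊤ : ℕ∞) φ → HasCompactSupport φ →
      ∫ x, u x *
        ((∑ k : Fin n,
            fderiv ℝ (fun y => fderiv ℝ φ y (EuclideanSpace.single k (1 : ℝ))) x
              (EuclideanSpace.single k (1 : ℝ)))
          + lam * φ x) = 0) :
    u =ᵐ[volume] 0 := by
  have hint : Integrable u volume :=
    (integrableOn_iff_integrable_of_support_subset (subset_tsupport u)).1
      (hu.integrableOn_isCompact hsupp.isCompact)
  -- the Fourier transform vanishes off a sphere
  have key : ∀ ξ, (lam - ((4 * Real.pi ^ 2 * ‖ξ‖ ^ 2 : ℝ) : ℂ)) * 𝓕 u ξ = 0 := by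
    intro ξ
    obtain ⟨R, hR0, hR⟩ := hsupp.isCompact.isBounded.subset_ball_lt 0 0
    let χ : ContDiffBump (0 : EuclideanSpace ℝ (Fin n)) := ⟨R, R + 1, hR0, by linarith⟩
    have hφ := h (fun x => (χ x : ℂ) * planeWave ξ x)
      ((Complex.ofRealCLM.contDiff.comp χ.contDiff).mul (planeWave_contDiff ξ))
      ((χ.hasCompactSupport.comp_left (g := fun r : ℝ => (r : ℂ)) (by simp)).mul_right)
    rw [Real.fourier_eq', ← integral_const_mul, ← hφ]
    refine integral_congr_ae (Filter.Eventually.of_forall fun x => ?_)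
    by_cases hx : x ∈ tsupport u
    · have hev : (fun x => (χ x : ℂ) * planeWave ξ x) =ᶠ[nhds x] planeWave ξ := by
        filter_upwards [Metric.isOpen_ball.mem_nhds (hR hx)] with y hy
        rw [χ.one_of_mem_closedBall (Metric.ball_subset_closedBall hy)]
        simp
      have hsum : ∀ k : Fin n,
          fderiv ℝ (fun y => fderiv ℝ (fun x => (χ x : ℂ) * planeWave ξ x) y
            (EuclideanSpace.single k (1 : ℝ))) x (EuclideanSpace.single k (1 : ℝ))
          = fderiv ℝ (fun y => fderiv ℝ (planeWave ξ) y
            (EuclideanSpace.single k (1 : ℝ))) x (EuclideanSpace.single k (1 : ℝ)) := by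
        intro k
        have : (fun y => fderiv ℝ (fun x => (χ x : ℂ) * planeWave ξ x) y
            (EuclideanSpace.single k (1 : ℝ))) =ᶠ[nhds x]
            (fun y => fderiv ℝ (planeWave ξ) y (EuclideanSpace.single k (1 : ℝ))) := by
          filter_upwards [hev.fderiv (𝕜 := ℝ)] with y hy
          rw [hy]
        rw [this.fderiv_eq]
      have hxe := hev.eq_of_nhds
      simp only at hxe ⊢
      rw [Finset.sum_congr rfl (fun k _ => hsum k), planeWave_laplacian, hxe, smul_eq_mul]
      change _ * (planeWave ξ x * u x) = _
      ring
    · simp [image_eq_zero_of_notMem_tsupport hx]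
  have hF : ∀ᵐ ξ, 𝓕 u ξ = 0 := by
    have : Nonempty (Fin n) := ⟨⟨0, hn⟩⟩
    have hs := Measure.addHaar_sphere (volume : Measure (EuclideanSpace ℝ (Fin n))) 0
      (Real.sqrt (lam.re / (4 * Real.pi ^ 2)))
    filter_upwards [measure_eq_zero_iff_ae_notMem.1 hs] with ξ hξ
    refine (mul_eq_zero.1 (key ξ)).resolve_left fun h0 => hξ ?_
    have h1 : lam.re = 4 * Real.pi ^ 2 * ‖ξ‖ ^ 2 := by
      rw [sub_eq_zero.1 h0, Complex.ofReal_re]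
    have hpi := Real.pi_pos
    rw [mem_sphere_zero_iff_norm, h1, mul_div_cancel_left₀ _ (by positivity),
      Real.sqrt_sq (norm_nonneg _)]
  refine ae_eq_zero_of_integral_contDiff_smul_eq_zero hu fun g hg hgs => ?_
  have hc : HasCompactSupport (fun x => (g x : ℂ)) :=
    hgs.comp_left (g := fun r : ℝ => (r : ℂ)) (by simp)
  let G := hc.toSchwartzMap (Complex.ofRealCLM.contDiff.comp hg)
  have hG : 𝓕 ((𝓕⁻ G : SchwartzMap _ ℂ) : EuclideanSpace ℝ (Fin n) → ℂ) = fun x => (g x : ℂ) := by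
    rw [← SchwartzMap.fourier_coe, FourierTransform.fourier_fourierInv_eq]
    rfl
  have hsw : ∫ ξ, 𝓕 u ξ • (𝓕⁻ G : SchwartzMap _ ℂ) ξ
      = ∫ x, u x • 𝓕 ((𝓕⁻ G : SchwartzMap _ ℂ) : EuclideanSpace ℝ (Fin n) → ℂ) x := by
    simpa using! VectorFourier.integral_fourierIntegral_smul_eq_flip
      (L := innerₗ (EuclideanSpace ℝ (Fin n)))
      Real.continuous_fourierChar continuous_inner hint (𝓕⁻ G : SchwartzMap _ ℂ).integrable
  rw [hG, integral_eq_zero_of_ae (by filter_upwards [hF] with ξ hξ; simp [hξ])] at hsw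
  rw [hsw]
  refine integral_congr_ae (Filter.Eventually.of_forall fun x => ?_)
  simp [mul_comm]
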